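/- Consider the game Γ_ex as an infinite-horizon discounted Markov game with discount factor γ = 2/3 and initial distribution ρ uniform over {s₁, s₂, s₃}. Then the correlated stationary policy σ is an exact (0-approximate) CCE, and V^σ_1(ρ) = V^σ_2(ρ) = −1/10. -/

import Mathlib

open Finset

section InfiniteHorizon

variable {n : ℕ} {S : Type*} [Fintype S] [DecidableEq S] {A : Fin n → Type*}
  [∀ k, Fintype (A k)] [∀ k, DecidableEq (A k)]

/-- `f` is a probability distribution on the finite type `α`. -/
def IsDist {α : Type*} [Fintype α] (f : α → ℝ) : Prop :=
  (∀ x, 0 ≤ f x) ∧ ∑ x, f x = 1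

/-- A stationary Markov policy: a distribution on `α` for every state. -/
def IsStatPol {S : Type*} {α : Type*} [Fintype α] (π : S → α → ℝ) : Prop :=
  ∀ s : S, IsDist (π s)

/-- A valid (stationary) transition kernel. -/
def IsKer (P : S → (∀ k, A k) → S → ℝ) : Prop :=
  ∀ s a, IsDist (P s a)

/-- Rewards take values in `[-1, 1]`. -/
def IsRew (r : Fin n → S → (∀ k, A k) → ℝ) : Prop :=
  ∀ k s a, r k s a ∈ Set.Icc (-1 : ℝ) 1

/-- `h`-step state-to-state transition matrix under the joint policy `σ`. -/
noncomputable def matPow (P : S → (∀ k, A k) → S → ℝ)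
    (σ : S → (∀ k, A k) → ℝ) : ℕ → S → S → ℝ
  | 0 => fun s s' => if s = s' then 1 else 0
  | h + 1 => fun s s' => ∑ t, matPow P σ h s t * ∑ a, σ t a * P t a s'

/-- Expected one-step reward under `σ`. -/
noncomputable def expRew (σ : S → (∀ k, A k) → ℝ)
    (rk : S → (∀ k, A k) → ℝ) (s : S) : ℝ :=
  ∑ a, σ s a * rk s a

/-- `vinf γ P rk σ s` is the expected `γ`-discounted infinite-horizon reward
`V^σ(s) = E[∑ₕ γ^(h-1) r(s_h, a_h)]`, started at state `s`. -/
noncomputable def vinf (γ : ℝ) (P : S → (∀ k, A k) → S → ℝ)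
    (rk : S → (∀ k, A k) → ℝ) (σ : S → (∀ k, A k) → ℝ) (s : S) : ℝ :=
  ∑' h : ℕ, γ ^ h * ∑ s', matPow P σ h s s' * expRew σ rk s'

/-- Value under the initial distribution `ρ`. -/
noncomputable def vinfρ (γ : ℝ) (P : S → (∀ k, A k) → S → ℝ)
    (rk : S → (∀ k, A k) → ℝ) (σ : S → (∀ k, A k) → ℝ) (ρ : S → ℝ) : ℝ :=
  ∑ s, ρ s * vinf γ P rk σ s

/-- The joint stationary policy in which player `k` plays `π'` independently
against the marginal `σ₋ₖ` of the joint policy `σ`. -/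
noncomputable def deviateI (k : Fin n) (π' : S → A k → ℝ)
    (σ : S → (∀ j, A j) → ℝ) : S → (∀ j, A j) → ℝ :=
  fun s a => π' s (a k) * ∑ b : A k, σ s (Function.update a k b)

/-- The marginal stationary policy of player `k` induced by `σ`. -/
noncomputable def marginalI (σ : S → (∀ j, A j) → ℝ) (k : Fin n) :
    S → A k → ℝ :=
  fun s b => ∑ a : ∀ j, A j, if a k = b then σ s a else 0

/-- The product policy induced by individual stationary policies `π k`. -/
def prodPolI (π : ∀ k, S → A k → ℝ) : S → (∀ j, A j) → ℝ :=
  fun s a => ∏ k, π k s (a k)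

/-- `σ` is an `ε`-approximate CCE of the discounted game (w.r.t. `ρ`). -/
def IsCCEI (γ : ℝ) (P : S → (∀ k, A k) → S → ℝ)
    (r : Fin n → S → (∀ k, A k) → ℝ) (ρ : S → ℝ) (ε : ℝ)
    (σ : S → (∀ k, A k) → ℝ) : Prop :=
  ∀ k : Fin n, ∀ π' : S → A k → ℝ, IsStatPol π' →
    vinfρ γ P (r k) (deviateI k π' σ) ρ - vinfρ γ P (r k) σ ρ ≤ ε

/-- The stationary product policy `π` is an `ε`-approximate NE (w.r.t. `ρ`). -/
def IsNEI (γ : ℝ) (P : S → (∀ k, A k) → S → ℝ)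
    (r : Fin n → S → (∀ k, A k) → ℝ) (ρ : S → ℝ) (ε : ℝ)
    (π : ∀ k, S → A k → ℝ) : Prop :=
  ∀ k : Fin n, ∀ π' : S → A k → ℝ, IsStatPol π' →
    vinfρ γ P (r k) (deviateI k π' (prodPolI π)) ρ -
      vinfρ γ P (r k) (prodPolI π) ρ ≤ ε

/-- `v` is the best-response value `V^{†,σ₋ₖ}_k(s)` of player `k` against `σ`. -/
def IsBRValI (γ : ℝ) (P : S → (∀ k, A k) → S → ℝ)
    (rk : S → (∀ k, A k) → ℝ) (σ : S → (∀ k, A k) → ℝ)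
    (k : Fin n) (s : S) (v : ℝ) : Prop :=
  IsGreatest {x : ℝ | ∃ π' : S → A k → ℝ, IsStatPol π' ∧
    x = vinf γ P rk (deviateI k π' σ) s} v

/-- The game is zero-sum polymatrix. -/
def IsZSPolymatrixI (r : Fin n → S → (∀ k, A k) → ℝ) : Prop :=
  (∀ s a, ∑ k, r k s a = 0) ∧
  ∃ q : (k : Fin n) → (j : Fin n) → S → A k → A j → ℝ,
    (∀ k j s x y, q k j s x y ∈ Set.Icc (-1 : ℝ) 1) ∧
    ∀ k s a, r k s a = ∑ j ∈ univ.filter (fun j => j ≠ k), q k j s (a k) (a j)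

/-- Switching control: at every state a single player controls the transition. -/
def SwitchingControlI (P : S → (∀ k, A k) → S → ℝ) : Prop :=
  ∀ s : S, ∃ k : Fin n, ∀ a a' : ∀ j, A j, a k = a' k → P s a = P s a'

/-- Feasibility for the nonlinear program `P_NE'`. -/
def FeasNEI (γ : ℝ) (P : S → (∀ k, A k) → S → ℝ)
    (r : Fin n → S → (∀ k, A k) → ℝ)
    (π : ∀ k, S → A k → ℝ) (w : Fin n → S → ℝ) : Prop :=
  (∀ k, IsStatPol (π k)) ∧
  ∀ k : Fin n, ∀ s, ∀ b : A k,
    (∑ a : ∀ j, A j, if a k = b then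
        (∏ j ∈ univ.filter (fun j => j ≠ k), π j s (a j)) *
          (r k s a + γ * ∑ s', P s a s' * w k s')
      else 0) ≤ w k s

/-- Objective of the nonlinear program `P_NE'`. -/
noncomputable def objNEI (γ : ℝ) (P : S → (∀ k, A k) → S → ℝ)
    (r : Fin n → S → (∀ k, A k) → ℝ) (ρ : S → ℝ)
    (π : ∀ k, S → A k → ℝ) (w : Fin n → S → ℝ) : ℝ :=
  ∑ k, ∑ s, ρ s * (w k s - vinf γ P (r k) (prodPolI π) s)

/-- Feasibility for the best-response linear program `P_BR'(σ̂)`. -/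
def FeasBRI (γ : ℝ) (P : S → (∀ k, A k) → S → ℝ)
    (r : Fin n → S → (∀ k, A k) → ℝ)
    (σ' : S → (∀ k, A k) → ℝ) (w : Fin n → S → ℝ) : Prop :=
  ∀ k : Fin n, ∀ s, ∀ b : A k,
    (∑ a : ∀ j, A j, if a k = b then
        (∑ b' : A k, σ' s (Function.update a k b')) *
          (r k s a + γ * ∑ s', P s a s' * w k s')
      else 0) ≤ w k s

/-- Objective of the best-response linear program `P_BR'(σ̂)`. -/
noncomputable def objBRI (γ : ℝ) (P : S → (∀ k, A k) → S → ℝ)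
    (r : Fin n → S → (∀ k, A k) → ℝ) (ρ : S → ℝ)
    (σ' : S → (∀ k, A k) → ℝ) (w : Fin n → S → ℝ) : ℝ :=
  ∑ k, ∑ s, ρ s * (w k s - vinf γ P (r k) σ' s)

end InfiniteHorizon
section ExampleIH

/-- States of the example game: `0 = s₁`, `1 = s₂`, `2 = s₃`. -/
abbrev Sex : Type := Fin 3

/-- Action sets: players `0` and `1` have two actions (`0 = a₁/b₁`,
`1 = a₂/b₂`), player `2` has a single action. -/
abbrev Aex : Fin 3 → Type := fun k => Fin (![2, 2, 1] k)

/-- Reward of player 1 (index 0). -/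
noncomputable def r1ex (s : Sex) (a : ∀ k, Aex k) : ℝ :=
  if s = 2 then -(1 / 2) else if (a 0).val = 0 then 1 / 20 else 0

/-- Reward of player 2 (index 1). -/
noncomputable def r2ex (s : Sex) (a : ∀ k, Aex k) : ℝ :=
  if s = 2 then -(1 / 2) else if (a 1).val = 0 then 1 / 20 else 0

/-- Rewards of the example game. -/
noncomputable def rexI : Fin 3 → Sex → (∀ k, Aex k) → ℝ :=
  fun k s a =>
    if k = 0 then r1ex s a
    else if k = 1 then r2ex s a
    else -(r1ex s a + r2ex s a)

/-- Transitions of the example game. -/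
noncomputable def PexI : Sex → (∀ k, Aex k) → Sex → ℝ :=
  fun s a s' =>
    if s = 2 then (if s' = 2 then 0 else 1 / 2)
    else if (a 0).val = 0 ∧ (a 1).val = 0 then (if s' = 2 then 1 else 0)
    else if s = 0 then (if s' = 1 then 1 else 0)
    else (if s' = 0 then 1 else 0)

/-- The correlated stationary policy `σ`: in every state, the joint actions
`(a₁, b₂)` and `(a₂, b₁)` are played with probability `1/2` each. -/
noncomputable def σexI : Sex → (∀ k, Aex k) → ℝ :=
  fun _ a => if (a 0).val ≠ (a 1).val then 1 / 2 else 0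

/-- The deterministic stationary policy of player 1 that always plays `a₂`. -/
noncomputable def devexI : Sex → Aex 0 → ℝ :=
  fun _ b => if b.val = 1 then 1 else 0

/-- The uniform initial distribution over the three states. -/
noncomputable def ρex : Sex → ℝ := fun _ => 1 / 3

end ExampleIH

section DiscountedValue

variable {n : ℕ} {S : Type*} [Fintype S] {A : Fin n → Type*} [∀ k, Fintype (A k)]
  {P : S → (∀ k, A k) → S → ℝ} {σ : S → (∀ k, A k) → ℝ}

/-- The one-step state transition probabilities under `σ` form a distribution. -/
theorem isDist_step (hP : IsKer P) (hσ : IsStatPol σ) (s : S) :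
    IsDist fun s' => ∑ a, σ s a * P s a s' := by
  refine ⟨fun s' => sum_nonneg fun a _ => mul_nonneg ((hσ s).1 a) ((hP s a).1 s'), ?_⟩
  rw [sum_comm]
  simp_rw [← mul_sum, (hP s _).2, mul_one]
  exact (hσ s).2

variable [DecidableEq S]

theorem isDist_matPow (hP : IsKer P) (hσ : IsStatPol σ) (h : ℕ) (s : S) :
    IsDist (matPow P σ h s) := by
  induction h with
  | zero => exact ⟨fun s' => by simp only [matPow]; split_ifs <;> simp, by simp [matPow]⟩
  | succ h ih =>
    refine ⟨fun s' => sum_nonneg fun t _ =>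
      mul_nonneg (ih.1 t) ((isDist_step hP hσ t).1 s'), ?_⟩
    simp only [matPow]
    rw [sum_comm]
    simp_rw [← mul_sum, (isDist_step hP hσ _).2, mul_one]
    exact ih.2

theorem abs_sum_matPow_mul_le (hP : IsKer P) (hσ : IsStatPol σ) (f : S → ℝ) (h : ℕ) (s : S) :
    |∑ s', matPow P σ h s s' * f s'| ≤ ∑ s', |f s'| := by
  have hM := isDist_matPow hP hσ h s
  refine (abs_sum_le_sum_abs _ _).trans (sum_le_sum fun s' _ => ?_)
  rw [abs_mul, abs_of_nonneg (hM.1 s')]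
  refine mul_le_of_le_one_left (abs_nonneg _) ?_
  rw [← hM.2]
  exact single_le_sum (fun t _ => hM.1 t) (mem_univ s')

theorem summable_discounted (hP : IsKer P) (hσ : IsStatPol σ) {γ : ℝ} (hγ0 : 0 ≤ γ) (hγ1 : γ < 1)
    (f : S → ℝ) (s : S) :
    Summable fun h : ℕ => γ ^ h * ∑ s', matPow P σ h s s' * f s' := by
  refine Summable.of_norm_bounded
    ((summable_geometric_of_lt_one hγ0 hγ1).mul_right (∑ s', |f s'|)) fun h => ?_
  rw [Real.norm_eq_abs, abs_mul, abs_of_nonneg (pow_nonneg hγ0 h)]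
  exact mul_le_mul_of_nonneg_left (abs_sum_matPow_mul_le hP hσ f h s) (pow_nonneg hγ0 h)

/-- A supersolution of the Bellman equation of `σ` dominates the value of `σ`. -/
theorem vinf_le_of_bellman_le (hP : IsKer P) (hσ : IsStatPol σ) {γ : ℝ} (hγ0 : 0 ≤ γ)
    (hγ1 : γ < 1) {rk : S → (∀ k, A k) → ℝ} {W : S → ℝ}
    (hW : ∀ s, expRew σ rk s + γ * ∑ s', (∑ a, σ s a * P s a s') * W s' ≤ W s) (s : S) :
    vinf γ P rk σ s ≤ W s := by
  have hpartial (N : ℕ) : ∑ h ∈ range N, γ ^ h * ∑ s', matPow P σ h s s' * expRew σ rk s' ≤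
      W s - γ ^ N * ∑ s', matPow P σ N s s' * W s' := by
    induction N with
    | zero => simp [matPow]
    | succ N ih =>
      have hstep : ∑ s', matPow P σ (N + 1) s s' * W s' =
          ∑ t, matPow P σ N s t * ∑ s', (∑ a, σ t a * P t a s') * W s' := by
        simp only [matPow, sum_mul, mul_sum, mul_assoc]
        rw [sum_comm]
      have hle : ∑ t, matPow P σ N s t * expRew σ rk t +
          γ * ∑ s', matPow P σ (N + 1) s s' * W s' ≤ ∑ t, matPow P σ N s t * W t := by
        rw [hstep, mul_sum, ← sum_add_distrib]
        refine sum_le_sum fun t _ => ?_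
        have := mul_le_mul_of_nonneg_left (hW t) ((isDist_matPow hP hσ N s).1 t)
        linarith
      have := mul_le_mul_of_nonneg_left hle (pow_nonneg hγ0 N)
      rw [sum_range_succ, pow_succ]
      linarith
  have hlim := (summable_discounted hP hσ hγ0 hγ1 W s).tendsto_atTop_zero.const_sub (W s)
  rw [sub_zero] at hlim
  exact le_of_tendsto_of_tendsto'
    (summable_discounted hP hσ hγ0 hγ1 (expRew σ rk) s).hasSum.tendsto_sum_nat hlim hpartial

/-- The solution of the Bellman equation of `σ` is the value of `σ`. -/
theorem vinf_eq_of_bellman_eq (hP : IsKer P) (hσ : IsStatPol σ) {γ : ℝ} (hγ0 : 0 ≤ γ)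
    (hγ1 : γ < 1) {rk : S → (∀ k, A k) → ℝ} {W : S → ℝ}
    (hW : ∀ s, expRew σ rk s + γ * ∑ s', (∑ a, σ s a * P s a s') * W s' = W s) (s : S) :
    vinf γ P rk σ s = W s := by
  refine le_antisymm (vinf_le_of_bellman_le hP hσ hγ0 hγ1 (fun t => (hW t).le) s) ?_
  have hneg : expRew σ (fun t a => -rk t a) = fun t => -expRew σ rk t := by
    funext t
    simp [expRew]
  have hle := vinf_le_of_bellman_le hP hσ hγ0 hγ1 (rk := fun t a => -rk t a)
    (W := fun t => -W t) (fun t => by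
      have := hW t
      simp only [hneg, mul_neg, sum_neg_distrib]
      linarith) s
  have hv : vinf γ P (fun t a => -rk t a) σ s = -vinf γ P rk σ s := by
    simp only [vinf, hneg, mul_neg, sum_neg_distrib, tsum_neg]
  linarith

end DiscountedValue

section ExampleComputations

/-- The joint action of the example game in which the first two players play `x` and `y`. -/
def jointEx (x y : Fin 2) : ∀ k, Aex k
  | 0 => x
  | 1 => y
  | 2 => (0 : Fin 1)

theorem sum_jointEx (f : (∀ k, Aex k) → ℝ) :
    ∑ a, f a = f (jointEx 0 0) + f (jointEx 0 1) + f (jointEx 1 0) + f (jointEx 1 1) := by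
  have huniv : (univ : Finset (∀ k, Aex k)) =
      {jointEx 0 0, jointEx 0 1, jointEx 1 0, jointEx 1 1} := by decide
  rw [huniv, sum_insert (by decide), sum_insert (by decide), sum_insert (by decide),
    sum_singleton]
  ring

theorem sum_Aex_zero (f : Aex 0 → ℝ) : ∑ b, f b = f (0 : Fin 2) + f (1 : Fin 2) :=
  Fin.sum_univ_two f

theorem sum_Aex_one (f : Aex 1 → ℝ) : ∑ b, f b = f (0 : Fin 2) + f (1 : Fin 2) :=
  Fin.sum_univ_two f

theorem sum_Aex_two (f : Aex 2 → ℝ) : ∑ b, f b = f (0 : Fin 1) :=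
  Fin.sum_univ_one f

theorem jointEx_zero (x y : Fin 2) : jointEx x y 0 = x := rfl

theorem jointEx_one (x y : Fin 2) : jointEx x y 1 = y := rfl

theorem σexI_jointEx (s : Sex) (x y : Fin 2) :
    σexI s (jointEx x y) = if x ≠ y then 1 / 2 else 0 := by
  simp only [σexI, jointEx_zero, jointEx_one, ne_eq, Fin.val_inj]

theorem isKer_PexI : IsKer PexI := by
  intro s a
  constructor
  · intro s'
    unfold PexI
    split_ifs <;> norm_num
  · rw [Fin.sum_univ_three]
    unfold PexI
    split_ifs <;> simp_all
    norm_num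

theorem isStatPol_σexI : IsStatPol σexI := by
  intro s
  constructor
  · intro a
    unfold σexI
    split_ifs <;> norm_num
  · rw [sum_jointEx]
    simp only [σexI_jointEx]
    norm_num

theorem deviateI_zero_σexI (π' : Sex → Aex 0 → ℝ) (s : Sex) (x y : Fin 2) :
    deviateI 0 π' σexI s (jointEx x y) = π' s x * (1 / 2) := by
  have hup (b : Fin 2) : Function.update (jointEx x y) 0 b = jointEx b y := by
    funext k
    fin_cases k <;> rfl
  simp only [deviateI, sum_Aex_zero, jointEx_zero]
  rw [hup 0, hup 1, σexI_jointEx, σexI_jointEx]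
  fin_cases y <;> simp

theorem deviateI_one_σexI (π' : Sex → Aex 1 → ℝ) (s : Sex) (x y : Fin 2) :
    deviateI 1 π' σexI s (jointEx x y) = π' s y * (1 / 2) := by
  have hup (b : Fin 2) : Function.update (jointEx x y) 1 b = jointEx x b := by
    funext k
    fin_cases k <;> rfl
  simp only [deviateI, sum_Aex_one, jointEx_one]
  rw [hup 0, hup 1, σexI_jointEx, σexI_jointEx]
  fin_cases x <;> simp

theorem deviateI_two_σexI (π' : Sex → Aex 2 → ℝ) (hπ : IsStatPol π') :
    deviateI 2 π' σexI = σexI := by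
  funext s a
  have hsum := (hπ s).2
  rw [sum_Aex_two] at hsum
  have h0 : a 2 = (0 : Fin 1) := Subsingleton.elim (α := Fin 1) _ _
  have hup : Function.update a 2 (0 : Fin 1) = a := by
    rw [← h0, Function.update_eq_self]
  simp only [deviateI, sum_Aex_two]
  rw [h0, hsum, hup, one_mul]

theorem forall_jointEx {p : (∀ k, Aex k) → Prop} (h : ∀ x y, p (jointEx x y)) (a : ∀ k, Aex k) :
    p a := by
  have ha : a = jointEx (a 0) (a 1) := by
    funext k
    fin_cases k
    · rfl
    · rfl
    · exact Subsingleton.elim (α := Fin 1) _ _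
  rw [ha]
  exact h _ _

theorem isStatPol_deviateI_zero {π' : Sex → Aex 0 → ℝ} (hπ : IsStatPol π') :
    IsStatPol (deviateI 0 π' σexI) := by
  intro s
  refine ⟨forall_jointEx fun x y => ?_, ?_⟩
  · rw [deviateI_zero_σexI]
    exact mul_nonneg ((hπ s).1 x) (by norm_num)
  · have hsum := (hπ s).2
    rw [sum_Aex_zero] at hsum
    simp only [sum_jointEx, deviateI_zero_σexI]
    linarith

theorem isStatPol_deviateI_one {π' : Sex → Aex 1 → ℝ} (hπ : IsStatPol π') :
    IsStatPol (deviateI 1 π' σexI) := by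
  intro s
  refine ⟨forall_jointEx fun x y => ?_, ?_⟩
  · rw [deviateI_one_σexI]
    exact mul_nonneg ((hπ s).1 y) (by norm_num)
  · have hsum := (hπ s).2
    rw [sum_Aex_one] at hsum
    simp only [sum_jointEx, deviateI_one_σexI]
    linarith

theorem vinfρ_ρex (γ : ℝ) (rk : Sex → (∀ k, Aex k) → ℝ) (σ : Sex → (∀ k, Aex k) → ℝ) :
    vinfρ γ PexI rk σ ρex =
      (vinf γ PexI rk σ 0 + vinf γ PexI rk σ 1 + vinf γ PexI rk σ 2) / 3 := by
  rw [vinfρ, Fin.sum_univ_three]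
  simp only [ρex]
  ring

/-- The value of `σexI` for the first two players, state by state. -/
theorem vinf_σexI {k : Fin 3} (hk : k = 0 ∨ k = 1) (s : Sex) :
    vinf (2 / 3) PexI (rexI k) σexI s = ![3 / 40, 3 / 40, -(9 / 20)] s := by
  refine vinf_eq_of_bellman_eq isKer_PexI isStatPol_σexI (by norm_num) (by norm_num)
    (fun s => ?_) s
  rcases hk with rfl | rfl <;> fin_cases s <;>
    simp [expRew, sum_jointEx, σexI_jointEx, Fin.sum_univ_three, PexI, rexI, r1ex, r2ex,
      jointEx_zero, jointEx_one] <;> norm_num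

theorem vinfρ_σexI {k : Fin 3} (hk : k = 0 ∨ k = 1) :
    vinfρ (2 / 3) PexI (rexI k) σexI ρex = -(1 / 10) := by
  simp only [vinfρ_ρex, vinf_σexI hk]
  norm_num [Matrix.cons_val_two]

theorem vinf_deviateI_zero_le {π' : Sex → Aex 0 → ℝ} (hπ : IsStatPol π') (s : Sex) :
    vinf (2 / 3) PexI (rexI 0) (deviateI 0 π' σexI) s ≤ ![0, 0, -(1 / 2)] s := by
  refine vinf_le_of_bellman_le isKer_PexI (isStatPol_deviateI_zero hπ) (by norm_num)
    (by norm_num) (fun s => ?_) s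
  have hsum := (hπ s).2
  have h0 := (hπ s).1 (0 : Fin 2)
  rw [sum_Aex_zero] at hsum
  fin_cases s <;>
    simp [expRew, sum_jointEx, deviateI_zero_σexI, Fin.sum_univ_three, PexI, rexI, r1ex,
      jointEx_zero, jointEx_one] at hsum h0 ⊢ <;> linarith

theorem vinf_deviateI_one_le {π' : Sex → Aex 1 → ℝ} (hπ : IsStatPol π') (s : Sex) :
    vinf (2 / 3) PexI (rexI 1) (deviateI 1 π' σexI) s ≤ ![0, 0, -(1 / 2)] s := by
  refine vinf_le_of_bellman_le isKer_PexI (isStatPol_deviateI_one hπ) (by norm_num)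
    (by norm_num) (fun s => ?_) s
  have hsum := (hπ s).2
  have h0 := (hπ s).1 (0 : Fin 2)
  rw [sum_Aex_one] at hsum
  fin_cases s <;>
    simp [expRew, sum_jointEx, deviateI_one_σexI, Fin.sum_univ_three, PexI, rexI, r2ex,
      jointEx_zero, jointEx_one] at hsum h0 ⊢ <;> linarith

end ExampleComputations

theorem example_sigma_is_CCE_discounted :
    IsCCEI (2 / 3) PexI rexI ρex 0 σexI ∧
    vinfρ (2 / 3) PexI (rexI 0) σexI ρex = -(1 / 10) ∧
    vinfρ (2 / 3) PexI (rexI 1) σexI ρex = -(1 / 10) := by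
  refine ⟨fun k π' hπ => ?_, vinfρ_σexI (Or.inl rfl), vinfρ_σexI (Or.inr rfl)⟩
  match k with
  | 0 =>
    have hle := vinf_deviateI_zero_le hπ
    rw [vinfρ_σexI (Or.inl rfl), vinfρ_ρex]
    have h0 := hle 0
    have h1 := hle 1
    have h2 := hle 2
    simp only [Matrix.cons_val] at h0 h1 h2
    linarith
  | 1 =>
    have hle := vinf_deviateI_one_le hπ
    rw [vinfρ_σexI (Or.inr rfl), vinfρ_ρex]
    have h0 := hle 0
    have h1 := hle 1
    have h2 := hle 2
    simp only [Matrix.cons_val] at h0 h1 h2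
    linarith
  | 2 => rw [deviateI_two_σexI π' hπ, sub_self]
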